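/- arXiv:2010.12429 — 2 statements merged into one kernel-verified Lean document; each statement's English description precedes it below -/
import Mathlib

section
/- Let 𝒞 ≤ RG be a relative projective group code. Then there exist s ∈ ℕ, pairwise orthogonal primitive idempotents ε_1, …, ε_s ∈ RG, and natural numbers a_1, …, a_s such that 𝒞 = ⨁_{i=1}^s π^{a_i} RG ε_i (an internal direct sum of RG-submodules). -/
/-- A module `M` over the group algebra `RG` is relative projective (for the trivial
subgroup of `G`) if every surjective `RG`-module homomorphism `φ : N → M` admitting an
`R`-linear section admits an `RG`-linear section. -/
def IsRelativelyProjective (R : Type) [CommRing R] (G : Type) [Group G]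
    (M : Type) [AddCommGroup M] [Module (MonoidAlgebra R G) M] : Prop :=
  ∀ (N : Type) [AddCommGroup N] [Module (MonoidAlgebra R G) N]
    (φ : N →ₗ[MonoidAlgebra R G] M),
    Function.Surjective φ →
    (∃ ψ : M →+ N,
      (∀ (r : R) (m : M),
        ψ (algebraMap R (MonoidAlgebra R G) r • m) = algebraMap R (MonoidAlgebra R G) r • ψ m) ∧
      ∀ m, φ (ψ m) = m) →
    ∃ ψ' : M →ₗ[MonoidAlgebra R G] N, ∀ m, φ (ψ' m) = m

/-- An idempotent of a ring is primitive if it is nonzero and is not the sum of two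
nonzero orthogonal idempotents. -/
def IsPrimitiveIdempotent {A : Type*} [Ring A] (e : A) : Prop :=
  IsIdempotentElem e ∧ e ≠ 0 ∧
    ¬ ∃ f g : A, IsIdempotentElem f ∧ IsIdempotentElem g ∧ f ≠ 0 ∧ g ≠ 0 ∧
        f * g = 0 ∧ g * f = 0 ∧ e = f + g

/-- In an Artinian ring every idempotent is a finite sum of pairwise orthogonal primitive
idempotents. -/
theorem exists_orthogonal_primitive_sum {A : Type*} [Ring A] [IsArtinianRing A] (e : A)
    (he : IsIdempotentElem e) :
    ∃ (κ : Type) (_ : Fintype κ) (f : κ → A),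
      (∀ i, IsPrimitiveIdempotent (f i)) ∧ (∀ i j, i ≠ j → f i * f j = 0) ∧ ∑ i, f i = e := by
  induction h : (Ideal.span {e} : Ideal A) using WellFoundedLT.induction
    generalizing e with
  | ind I ih =>
    subst h
    by_cases h0 : e = 0
    · exact ⟨Empty, inferInstance, Empty.elim, by simp, by simp, by simp [h0]⟩
    by_cases hp : IsPrimitiveIdempotent e
    · exact ⟨Unit, inferInstance, fun _ => e, by simpa using hp, by simp, by simp⟩
    · obtain ⟨f, g, hf, hg, hf0, hg0, hfg, hgf, hefg⟩ :
          ∃ f g : A, IsIdempotentElem f ∧ IsIdempotentElem g ∧ f ≠ 0 ∧ g ≠ 0 ∧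
            f * g = 0 ∧ g * f = 0 ∧ e = f + g := by
        by_contra hne
        exact hp ⟨he, h0, hne⟩
      have key : ∀ f g : A, IsIdempotentElem f → IsIdempotentElem g → g ≠ 0 → f * g = 0 →
          g * f = 0 → e = f + g → (Ideal.span {f} : Ideal A) < Ideal.span {e} := by
        intro f g hf hg hg0 hfg hgf hefg
        refine lt_of_le_of_ne ?_ fun heq => hg0 ?_
        · rw [Ideal.span_singleton_le_iff_mem, Ideal.mem_span_singleton']
          exact ⟨f, by rw [hefg, mul_add, hf.eq, hfg, add_zero]⟩
        · have : g ∈ (Ideal.span {f} : Ideal A) := by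
            rw [heq, Ideal.mem_span_singleton']
            exact ⟨g, by rw [hefg, mul_add, hg.eq, hgf, zero_add]⟩
          obtain ⟨a, rfl⟩ := Ideal.mem_span_singleton'.1 this
          rw [← hg.eq, ← mul_assoc, mul_assoc a, mul_assoc a, mul_assoc f, hfg, mul_zero]
      obtain ⟨κ, _, u, hu, huo, hus⟩ := ih _ (key f g hf hg hg0 hfg hgf hefg) f hf rfl
      obtain ⟨κ', _, v, hv, hvo, hvs⟩ :=
        ih _ (key g f hg hf hf0 hgf hfg (by rw [hefg, add_comm])) g hg rfl
      have hOu : OrthogonalIdempotents u := ⟨fun i => (hu i).1, fun i j hij => huo i j hij⟩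
      have hOv : OrthogonalIdempotents v := ⟨fun i => (hv i).1, fun i j hij => hvo i j hij⟩
      have huf : ∀ i, u i * f = u i := fun i => by
        rw [← hus, hOu.mul_sum_of_mem (Finset.mem_univ i)]
      have hvg : ∀ i, v i * g = v i := fun i => by
        rw [← hvs, hOv.mul_sum_of_mem (Finset.mem_univ i)]
      have hfu : ∀ i, f * u i = u i := fun i => by
        classical
        simp [← hus, Finset.sum_mul, hOu.mul_eq]
      have hgv : ∀ i, g * v i = v i := fun i => by
        classical
        simp [← hvs, Finset.sum_mul, hOv.mul_eq]
      refine ⟨κ ⊕ κ', inferInstance, Sum.elim u v, ?_, ?_, ?_⟩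
      · rintro (i | i)
        exacts [hu i, hv i]
      · rintro (i | i) (j | j) hij
        · exact huo i j (by simpa using hij)
        · change u i * v j = 0
          rw [← huf, ← hgv, mul_assoc, ← mul_assoc f, hfg, zero_mul, mul_zero]
        · change v i * u j = 0
          rw [← hvg, ← hfu, mul_assoc, ← mul_assoc g, hgf, zero_mul, mul_zero]
        · exact hvo i j (by simpa using hij)
      · simp [hus, hvs, hefg]

/-- Idempotents lift along a ring homomorphism with nil kernel, and the lift can be chosen to be
a two-sided multiple of a given preimage. -/
theorem exists_isIdempotentElem_eq_mul {A B : Type*} [Ring A] [Ring B] (q : A →+* B)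
    (hq : ∀ x, q x = 0 → IsNilpotent x) (x : A) (hx : IsIdempotentElem (q x)) :
    ∃ e : A, IsIdempotentElem e ∧ q e = q x ∧ (∃ y, e = x * y) ∧ ∃ y, e = y * x := by
  obtain ⟨n, hn⟩ := hq (x - x ^ 2) (by simp [pow_two, hx.eq])
  have hn' : (x - x ^ 2) ^ (n + 1) = 0 := by rw [pow_succ, hn, zero_mul]
  have hdvd : (Polynomial.X : Polynomial ℤ) ∣
      1 - (1 - Polynomial.X ^ (n + 1)) ^ (n + 1) := by
    rw [Polynomial.X_dvd_iff, Polynomial.coeff_zero_eq_eval_zero]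
    simp
  obtain ⟨r, hr⟩ := hdvd
  have h1 : 1 - (1 - x ^ (n + 1)) ^ (n + 1) = x * Polynomial.aeval x r := by
    simpa using congrArg (Polynomial.aeval x) hr
  have h2 : 1 - (1 - x ^ (n + 1)) ^ (n + 1) = Polynomial.aeval x r * x := by
    rw [mul_comm] at hr
    simpa using congrArg (Polynomial.aeval x) hr
  refine ⟨_, isIdempotentElem_one_sub_one_sub_pow_pow x (n + 1) hn', ?_, ⟨_, h1⟩, ⟨_, h2⟩⟩
  simp only [map_sub, map_one, map_pow, hx.pow_succ_eq, hx.one_sub.pow_succ_eq, sub_sub_cancel]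

/-- If the images, modulo a nil ideal, of an increasing chain of left ideals `D n` are generated
by idempotents, then these images are generated by the images of initial segments of a
single family of orthogonal primitive idempotents lying in the `D n`. -/
theorem exists_orthogonal_primitive_chain {A B : Type*} [Ring A] [IsArtinianRing A] [Ring B]
    (q : A →+* B) (hq : ∀ x, q x = 0 → IsNilpotent x) (D : ℕ → Ideal A) (hD : Monotone D)
    (hgen : ∀ n, ∃ f ∈ D n, ∀ x ∈ D n, q x * q f = q x) (n : ℕ) :
    ∃ (ι : Type) (_ : Fintype ι) (e : ι → A) (a : ι → ℕ),
      (∀ i, IsPrimitiveIdempotent (e i)) ∧ (∀ i j, i ≠ j → e i * e j = 0) ∧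
      (∀ i, a i < n) ∧ (∀ i, e i ∈ D (a i)) ∧
      ∀ m < n, ∀ x ∈ D m, ∃ z ∈ Ideal.span (e '' {i | a i ≤ m}), q x = q z := by
  induction n with
  | zero => exact ⟨Empty, inferInstance, Empty.elim, Empty.elim, by simp⟩
  | succ n ih =>
    obtain ⟨ι, _, e, a, he, heo, ha, heD, hspan⟩ := ih
    obtain ⟨f, hfD, hf⟩ := hgen n
    have hO : OrthogonalIdempotents e := ⟨fun i => (he i).1, fun i j hij => heo i j hij⟩
    set E := ∑ i, e i with hE
    have hEI : IsIdempotentElem E := hO.isIdempotentElem_sum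
    have heE : ∀ i, e i * E = e i := fun i => hO.mul_sum_of_mem (Finset.mem_univ i)
    have hEe : ∀ i, E * e i = e i := fun i => by
      classical
      simp [hE, Finset.sum_mul, hO.mul_eq]
    have hED : E ∈ D n := sum_mem fun i _ => hD (ha i).le (heD i)
    have hff : q f * q f = q f := hf f hfD
    have hEf : q E * q f = q E := hf E hED
    have hEE : q E * q E = q E := by rw [← map_mul, hEI.eq]
    have hqx : q ((1 - E) * f * (1 - E)) = q f - q f * q E := by
      simp only [map_mul, map_sub, sub_mul, mul_sub, one_mul, mul_one, hEf, hEE]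
      abel
    have hfEf : q f * q E * q f = q f * q E := by rw [mul_assoc, hEf]
    have hfEfE : q f * q E * (q f * q E) = q f * q E := by rw [← mul_assoc, hfEf, mul_assoc, hEE]
    have hfI : IsIdempotentElem (q ((1 - E) * f * (1 - E))) := by
      rw [hqx, IsIdempotentElem, sub_mul, mul_sub, mul_sub, hff, ← mul_assoc, hff, hfEf, hfEfE]
      abel
    obtain ⟨ε, hε, hqε, ⟨y, hy⟩, ⟨y', hy'⟩⟩ := exists_isIdempotentElem_eq_mul q hq _ hfI
    have hEε : E * ε = 0 := by
      rw [hy, ← mul_assoc, ← mul_assoc, ← mul_assoc, hEI.mul_one_sub_self]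
      simp
    have hεE : ε * E = 0 := by
      rw [hy', mul_assoc, mul_assoc, hEI.one_sub_mul_self]
      simp
    have hεD : ε ∈ D n := by
      rw [hy']
      refine (D n).mul_mem_left _ ?_
      rw [mul_sub, mul_one]
      exact (D n).sub_mem ((D n).mul_mem_left _ hfD) ((D n).mul_mem_left _ hED)
    obtain ⟨κ, _, u, hu, huo, hus⟩ := exists_orthogonal_primitive_sum ε hε
    have hOu : OrthogonalIdempotents u := ⟨fun i => (hu i).1, fun i j hij => huo i j hij⟩
    have huε : ∀ i, u i * ε = u i := fun i => by
      rw [← hus, hOu.mul_sum_of_mem (Finset.mem_univ i)]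
    have hεu : ∀ i, ε * u i = u i := fun i => by
      classical
      simp [← hus, Finset.sum_mul, hOu.mul_eq]
    refine ⟨ι ⊕ κ, inferInstance, Sum.elim e u, Sum.elim a fun _ => n, ?_, ?_, ?_, ?_, ?_⟩
    · rintro (i | i)
      exacts [he i, hu i]
    · rintro (i | i) (j | j) hij
      · exact heo i j (by simpa using hij)
      · change e i * u j = 0
        rw [← heE, ← hεu, mul_assoc, ← mul_assoc E, hEε, zero_mul, mul_zero]
      · change u i * e j = 0
        rw [← huε, ← hEe, mul_assoc, ← mul_assoc ε, hεE, zero_mul, mul_zero]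
      · exact huo i j (by simpa using hij)
    · rintro (i | i)
      exacts [(ha i).trans (Nat.lt_succ_self n), Nat.lt_succ_self n]
    · rintro (i | i)
      · exact heD i
      · change u i ∈ D n
        rw [← huε]
        exact (D n).mul_mem_left _ hεD
    · intro m hm x hx
      obtain hm | rfl := Nat.lt_succ_iff_lt_or_eq.1 hm
      · obtain ⟨z, hz, hxz⟩ := hspan m hm x hx
        refine ⟨z, Ideal.span_mono ?_ hz, hxz⟩
        rintro _ ⟨i, hi, rfl⟩
        exact ⟨Sum.inl i, hi, rfl⟩
      · refine ⟨x * ε + x * f * E, ?_, ?_⟩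
        · refine add_mem (Ideal.mul_mem_left _ _ ?_) (Ideal.mul_mem_left _ _ ?_)
          · rw [← hus]
            exact sum_mem fun i _ => Ideal.subset_span ⟨Sum.inr i, le_refl m, rfl⟩
          · exact sum_mem fun i _ => Ideal.subset_span ⟨Sum.inl i, (ha i).le, rfl⟩
        · rw [map_add, map_mul, map_mul, map_mul, hqε, hqx, mul_sub, hf x hx, ← mul_assoc, hf x hx,
            sub_add_cancel]

open scoped TensorProduct in
/-- Higman's criterion: the identity of a relatively projective module is the trace of an
`R`-linear endomorphism. -/
theorem IsRelativelyProjective.exists_sum_conjugate_eq {R G M : Type} [CommRing R] [Group G]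
    [Fintype G] [AddCommGroup M] [Module R M] [Module (MonoidAlgebra R G) M]
    [IsScalarTower R (MonoidAlgebra R G) M] (hM : IsRelativelyProjective R G M) :
    ∃ θ : M →ₗ[R] M, ∀ m, ∑ g : G, θ.conjugate g m = m := by
  have := IsScalarTower.to_smulCommClass (R := R) (A := MonoidAlgebra R G) (M := M)
  let φ : MonoidAlgebra R G ⊗[R] M →ₗ[MonoidAlgebra R G] M :=
    TensorProduct.AlgebraTensorModule.lift
      (LinearMap.toSpanSingleton (MonoidAlgebra R G) (M →ₗ[R] M) LinearMap.id)
  have hφ : ∀ a m, φ (a ⊗ₜ[R] m) = a • m := fun a m => by simp [φ]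
  let t : MonoidAlgebra R G ⊗[R] M →ₗ[R] M :=
    TensorProduct.lift ((LinearMap.lsmul R M).comp
      ((Finsupp.lapply 1).comp (MonoidAlgebra.coeffLinearEquiv R).toLinearMap))
  have ht : ∀ a m, t (a ⊗ₜ[R] m) = a.coeff 1 • m := fun a m => by simp [t]
  have ht1 : ∀ m, t.sumOfConjugatesEquivariant G (1 ⊗ₜ[R] m) = m := fun m => by
    classical
    rw [LinearMap.sumOfConjugatesEquivariant_apply, Finset.sum_eq_single 1]
    · simp [LinearMap.conjugate_apply, ← MonoidAlgebra.one_def, ht]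
    · intro g _ hg
      simp [LinearMap.conjugate_apply, TensorProduct.smul_tmul', ht, hg]
    · simp
  have key : t.sumOfConjugatesEquivariant G = φ := by
    refine TensorProduct.AlgebraTensorModule.ext fun a m => ?_
    rw [← mul_one a, ← smul_eq_mul, ← TensorProduct.smul_tmul', map_smul, map_smul, ht1, hφ,
      one_smul]
  obtain ⟨ψ, hψ⟩ := hM _ φ (fun m => ⟨1 ⊗ₜ[R] m, by simp [hφ]⟩)
    ⟨(TensorProduct.mk R (MonoidAlgebra R G) M 1).toAddMonoidHom, fun r m => by
      simp only [algebraMap_smul, LinearMap.toAddMonoidHom_coe, map_smul], fun m => by simp [hφ]⟩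
  refine ⟨t.comp (ψ.restrictScalars R), fun m => ?_⟩
  conv_rhs => rw [← hψ m, ← key, LinearMap.sumOfConjugatesEquivariant_apply]
  simp [LinearMap.conjugate_apply]

/-- In a local ring with maximal ideal `(π)`, if no power of `π` below `π ^ (a + j)` vanishes,
then the annihilator of `π ^ a` is contained in `(π ^ j)`. -/
theorem pow_dvd_of_mul_pow_eq_zero {R : Type*} [CommRing R] [IsLocalRing R] {π : R}
    (hπ : IsLocalRing.maximalIdeal R = Ideal.span {π}) {ℓ : ℕ}
    (h1 : ∀ k < ℓ, π ^ k ≠ 0) (j : ℕ) :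
    ∀ (a : ℕ) (r : R), a + j = ℓ → r * π ^ a = 0 → π ^ j ∣ r := by
  induction j with
  | zero => simp
  | succ j ih =>
    intro a r haj hr
    obtain ⟨s, rfl⟩ := ih (a + 1) r (by omega) (by rw [pow_succ, ← mul_assoc, hr, zero_mul])
    rw [pow_succ]
    refine mul_dvd_mul_left _ ?_
    rw [← Ideal.mem_span_singleton, ← hπ, IsLocalRing.mem_maximalIdeal, mem_nonunits_iff]
    intro hs
    refine h1 (a + j) (by omega) ?_
    rw [← hs.mul_left_eq_zero, ← hr]
    ring

/-- Coefficientwise divisibility: if the annihilator of `u` lies in `(v)`, then every element of the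
monoid algebra killed by `u` is a multiple of `v`. -/
theorem MonoidAlgebra.exists_smul_eq_of_smul_eq_zero {R G : Type*} [CommRing R] [Monoid G]
    {u v : R} (huv : ∀ r : R, r * u = 0 → v ∣ r) (x : MonoidAlgebra R G) (hx : u • x = 0) :
    ∃ y, x = v • y := by
  classical
  have : ∀ g, ∃ s, x.coeff g = v * s := fun g => huv _ <| by
    rw [mul_comm]
    simpa using congrArg (fun z => z.coeff g) hx
  choose s hs using this
  refine ⟨.ofCoeff (Finsupp.onFinset x.coeff.support (fun g => if x.coeff g = 0 then 0 else s g)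
    (by simp +contextual)), ?_⟩
  ext g
  by_cases h : x.coeff g = 0
  · simp [h]
  · simpa [h] using hs g

/-- Submodules of a module killed by a maximal ideal are direct summands. -/
theorem exists_retraction_to_submodule {R M : Type*} [CommRing R] [AddCommGroup M] [Module R M]
    (I : Ideal R) [I.IsMaximal] (hM : Module.IsTorsionBySet R M I) (W : Submodule R M) :
    ∃ p : M →ₗ[R] W, ∀ w : W, p w = w := by
  let _ := hM.module
  let _ := Ideal.Quotient.field I
  have : IsSemisimpleModule R M := hM.isSemisimpleModule_iff.1 inferInstance
  obtain ⟨V, hV⟩ := exists_isCompl W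
  exact ⟨W.projectionOnto V hV, fun w => by simp⟩

/-- The left ideal of all `x` with `r • x ∈ I`. -/
def leftIdealQuotient {R A : Type*} [CommRing R] [Ring A] [Algebra R A] (I : Ideal A) (r : R) :
    Ideal A where
  carrier := {x | r • x ∈ I}
  add_mem' hx hy := by
    rw [Set.mem_ofPred_eq, smul_add]
    exact I.add_mem hx hy
  zero_mem' := by simp
  smul_mem' a x hx := by
    rw [Set.mem_ofPred_eq, smul_eq_mul, ← mul_smul_comm]
    exact I.mul_mem_left a hx

theorem mem_leftIdealQuotient {R A : Type*} [CommRing R] [Ring A] [Algebra R A] {I : Ideal A}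
    {r : R} {x : A} : x ∈ leftIdealQuotient I r ↔ r • x ∈ I :=
  Iff.rfl

/-- The ideals `(𝒞 : π ^ j)` of a relatively projective code are, modulo `π`, generated by an
idempotent. -/
theorem exists_generator_leftIdealQuotient {R G : Type} [CommRing R] [IsLocalRing R] {π : R}
    (hπ : IsLocalRing.maximalIdeal R = Ideal.span {π}) {ℓ : ℕ} (h0 : π ^ ℓ = 0)
    (h1 : ∀ k < ℓ, π ^ k ≠ 0) [Group G] [Fintype G] {𝒞 : Ideal (MonoidAlgebra R G)}
    (h𝒞 : IsRelativelyProjective R G 𝒞) (j : ℕ) :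
    ∃ f ∈ leftIdealQuotient 𝒞 (π ^ j), ∀ x ∈ leftIdealQuotient 𝒞 (π ^ j),
      ∃ y, x * f - x = π • y := by
  obtain hj | hj := le_or_gt ℓ j
  · have : π ^ j = 0 := pow_eq_zero_of_le hj h0
    exact ⟨1, by simp [mem_leftIdealQuotient, this], fun x _ => ⟨0, by simp⟩⟩
  obtain ⟨n, rfl⟩ : ∃ n, ℓ = j + n + 1 := Nat.exists_eq_add_of_lt hj
  set D := leftIdealQuotient 𝒞 (π ^ j)
  obtain ⟨θ, hθ⟩ := h𝒞.exists_sum_conjugate_eq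
  let S := Submodule.torsionBy R (MonoidAlgebra R G) π
  let μ : MonoidAlgebra R G →ₗ[R] S :=
    (LinearMap.lsmul R (MonoidAlgebra R G) (π ^ (j + n))).codRestrict S fun x => by
      rw [Submodule.mem_torsionBy_iff, LinearMap.lsmul_apply, smul_smul, ← pow_succ', h0, zero_smul]
  have hμ : ∀ x, (μ x : MonoidAlgebra R G) = π ^ (j + n) • x := fun x => rfl
  let W : Submodule R S := (D.restrictScalars R).map μ
  have : (Ideal.span {π}).IsMaximal := hπ ▸ inferInstance
  obtain ⟨p, hp⟩ := exists_retraction_to_submodule (Ideal.span {π})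
    ((Module.isTorsionBySet_span_singleton_iff π).2
      (Submodule.torsionBy_isTorsionBy (R := R) (M := MonoidAlgebra R G) π)) W
  have hW : ∀ w : W, ((w : S) : MonoidAlgebra R G) ∈ 𝒞 := by
    rintro ⟨_, x, hx, rfl⟩
    change π ^ (j + n) • x ∈ 𝒞
    rw [add_comm, pow_add, mul_smul]
    exact Submodule.smul_of_tower_mem 𝒞 _ hx
  let incl : W →ₗ[R] 𝒞 :=
    { toFun := fun w => ⟨(w : S), hW w⟩
      map_add' := fun _ _ => rfl
      map_smul' := fun _ _ => rfl }
  let Θ : MonoidAlgebra R G →ₗ[R] 𝒞 := θ ∘ₗ incl ∘ₗ p ∘ₗ μ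
  have hΘD : ∀ x ∈ D, ∀ hx : π ^ (j + n) • x ∈ 𝒞, Θ x = θ ⟨π ^ (j + n) • x, hx⟩ := by
    intro x hx hx'
    have : p (μ x) = ⟨μ x, Submodule.mem_map_of_mem hx⟩ := hp ⟨μ x, Submodule.mem_map_of_mem hx⟩
    change θ (incl (p (μ x))) = _
    rw [this]
    rfl
  have hΘ : ∀ x, ∃ f ∈ D, (Θ x : MonoidAlgebra R G) = π ^ (j + n) • f := by
    intro x
    obtain ⟨⟨_, z, hz, rfl⟩, hz'⟩ : ∃ w : W, p (μ x) = w := ⟨_, rfl⟩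
    have hΘx : Θ x = π ^ n • θ ⟨π ^ j • z, hz⟩ := by
      rw [← map_smul]
      change θ (incl (p (μ x))) = _
      rw [hz']
      congr 1
      ext1
      change π ^ (j + n) • z = π ^ n • π ^ j • z
      rw [smul_smul, ← pow_add, add_comm]
    have hann : π ^ (n + 1) • (θ ⟨π ^ j • z, hz⟩ : MonoidAlgebra R G) = 0 := by
      have : π ^ (n + 1) • (⟨π ^ j • z, hz⟩ : 𝒞) = 0 := by
        ext1
        change π ^ (n + 1) • π ^ j • z = 0
        rw [smul_smul, ← pow_add, add_comm, ← add_assoc, h0, zero_smul]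
      have := congrArg θ this
      rw [map_smul, map_zero] at this
      exact congrArg Subtype.val this
    obtain ⟨f, hf⟩ := MonoidAlgebra.exists_smul_eq_of_smul_eq_zero
      (fun r => pow_dvd_of_mul_pow_eq_zero hπ h1 j (n + 1) r (by omega)) _ hann
    refine ⟨f, ?_, ?_⟩
    · rw [mem_leftIdealQuotient, ← hf]
      exact (θ _).2
    · rw [hΘx]
      change π ^ n • (θ ⟨π ^ j • z, hz⟩ : MonoidAlgebra R G) = _
      rw [hf, smul_smul, ← pow_add, add_comm]
  obtain ⟨f, hfD, hf⟩ : ∃ f ∈ D,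
      (Θ.sumOfConjugatesEquivariant G 1 : MonoidAlgebra R G) = π ^ (j + n) • f := by
    choose F hFD hF using hΘ
    refine ⟨∑ g : G, MonoidAlgebra.single g⁻¹ 1 * F (MonoidAlgebra.single g 1 * 1),
      sum_mem fun g _ => D.mul_mem_left _ (hFD _), ?_⟩
    rw [LinearMap.sumOfConjugatesEquivariant_apply, Finset.smul_sum, AddSubmonoidClass.coe_finsetSum]
    refine Finset.sum_congr rfl fun g _ => ?_
    rw [LinearMap.conjugate_apply, Submodule.coe_smul, smul_eq_mul, smul_eq_mul, hF, mul_smul_comm]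
  refine ⟨f, hfD, fun x hx => ?_⟩
  have hx𝒞 : ∀ x ∈ D, π ^ (j + n) • x ∈ 𝒞 := fun x hx => hW ⟨μ x, Submodule.mem_map_of_mem hx⟩
  have hretr : Θ.sumOfConjugatesEquivariant G x = ⟨π ^ (j + n) • x, hx𝒞 x hx⟩ := by
    rw [LinearMap.sumOfConjugatesEquivariant_apply, ← hθ ⟨π ^ (j + n) • x, hx𝒞 x hx⟩]
    refine Finset.sum_congr rfl fun g _ => ?_
    rw [LinearMap.conjugate_apply, LinearMap.conjugate_apply, smul_eq_mul,
      hΘD _ (D.mul_mem_left _ hx) (hx𝒞 _ (D.mul_mem_left _ hx))]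
    congr 3
    exact (mul_smul_comm _ _ _).symm
  have hlin : Θ.sumOfConjugatesEquivariant G x = x • Θ.sumOfConjugatesEquivariant G 1 := by
    rw [← map_smul, smul_eq_mul, mul_one]
  refine MonoidAlgebra.exists_smul_eq_of_smul_eq_zero (u := π ^ (j + n))
    (fun r hr => by simpa using pow_dvd_of_mul_pow_eq_zero hπ h1 1 (j + n) r rfl hr) _ ?_
  have := congrArg Subtype.val (hlin.symm.trans hretr)
  rw [Submodule.coe_smul, hf] at this
  rw [smul_sub, ← mul_smul_comm, sub_eq_zero]
  exact this

/-- Every relative projective group code `𝒞 ≤ RG` decomposes as a direct sum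
`𝒞 = ⨁_{i=1}^s π^{a_i} RG ε_i` for pairwise orthogonal primitive idempotents
`ε_i ∈ RG` and natural numbers `a_i`. -/
theorem relatively_projective_code_decomposition
    (R : Type) [CommRing R] [IsArtinianRing R] [IsLocalRing R]
    (π : R) (hπ : IsLocalRing.maximalIdeal R = Ideal.span {π})
    (ℓ : ℕ) (hℓ : 0 < ℓ)
    (hnil : IsLocalRing.maximalIdeal R ^ ℓ = ⊥)
    (hmin : ∀ k < ℓ, IsLocalRing.maximalIdeal R ^ k ≠ ⊥)
    (G : Type) [Group G] [Finite G]
    (𝒞 : Ideal (MonoidAlgebra R G)) (h𝒞 : IsRelativelyProjective R G 𝒞) :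
    ∃ (s : ℕ) (ε : Fin s → MonoidAlgebra R G) (a : Fin s → ℕ),
      (∀ i, IsPrimitiveIdempotent (ε i)) ∧
      (∀ i j, i ≠ j → ε i * ε j = 0) ∧
      -- `𝒞` is the internal direct sum of the left ideals `π^{a_i} RG ε_i`
      𝒞 = (⨆ i : Fin s, Ideal.span {π ^ a i • ε i} : Ideal (MonoidAlgebra R G)) ∧
      iSupIndep (fun i : Fin s =>
        (Ideal.span {π ^ a i • ε i} : Ideal (MonoidAlgebra R G))) := by
  have := Fintype.ofFinite G
  have h0 : π ^ ℓ = 0 := by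
    simpa [hπ, Ideal.span_singleton_pow] using hnil
  have h1 : ∀ k < ℓ, π ^ k ≠ 0 := fun k hk h => hmin k hk (by
    simp [hπ, Ideal.span_singleton_pow, h])
  have : IsArtinianRing (MonoidAlgebra R G) := by
    have : Module.Finite R (MonoidAlgebra R G) :=
      Module.Finite.equiv (MonoidAlgebra.coeffLinearEquiv R (S := R) (M := G)).symm
    exact isArtinian_of_tower R inferInstance
  let J : Ideal (MonoidAlgebra R G) := Ideal.span {algebraMap R (MonoidAlgebra R G) π}
  have hJ : ∀ x, x ∈ J ↔ ∃ y, x = π • y := fun x => by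
    simp only [J, Ideal.mem_span_singleton', Algebra.smul_def, Algebra.commutes, eq_comm]
  have : J.IsTwoSided := ⟨fun {a} b ha => by
    obtain ⟨y, rfl⟩ := (hJ a).1 ha
    exact (hJ _).2 ⟨y * b, by rw [smul_mul_assoc]⟩⟩
  have hq : ∀ x, Ideal.Quotient.mk J x = 0 ↔ ∃ y, x = π • y := fun x => by
    rw [Ideal.Quotient.eq_zero_iff_mem, hJ]
  let D : ℕ → Ideal (MonoidAlgebra R G) := fun j => leftIdealQuotient 𝒞 (π ^ j)
  have hD : Monotone D := monotone_nat_of_le_succ fun j x hx => by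
    rw [mem_leftIdealQuotient, pow_succ', mul_smul]
    exact Submodule.smul_of_tower_mem 𝒞 π hx
  obtain ⟨ι, _, e, a, he, heo, ha, heD, hspan⟩ := exists_orthogonal_primitive_chain
    (Ideal.Quotient.mk J) (fun x hx => by
      obtain ⟨y, rfl⟩ := (hq x).1 hx
      exact ⟨ℓ, by rw [smul_pow, h0, zero_smul]⟩) D hD (fun j => by
      obtain ⟨f, hf, h⟩ := exists_generator_leftIdealQuotient hπ h0 h1 h𝒞 j
      refine ⟨f, hf, fun x hx => ?_⟩
      rw [← map_mul, ← sub_eq_zero, ← map_sub, hq]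
      exact h x hx) ℓ
  have hle : ∀ k m, m + k = ℓ → ∀ x ∈ D m,
      π ^ m • x ∈ (⨆ i, Ideal.span {π ^ a i • e i} : Ideal (MonoidAlgebra R G)) := by
    intro k
    induction k with
    | zero =>
      rintro m hm x -
      rw [show m = ℓ from hm, h0, zero_smul]
      exact zero_mem _
    | succ k ih =>
      intro m hm x hx
      obtain ⟨z, hz, hxz⟩ := hspan m (by omega) x hx
      rw [← sub_eq_zero, ← map_sub, hq] at hxz
      obtain ⟨y, hy⟩ := hxz
      have hzD : z ∈ D m := by
        refine Ideal.span_le.2 ?_ hz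
        rintro _ ⟨i, hi, rfl⟩
        exact hD hi (heD i)
      have hyD : y ∈ D (m + 1) := by
        rw [mem_leftIdealQuotient, pow_succ, mul_smul, ← hy]
        exact (D m).sub_mem hx hzD
      have hz' : z ∈ leftIdealQuotient
          (⨆ i, Ideal.span {π ^ a i • e i} : Ideal (MonoidAlgebra R G)) (π ^ m) := by
        refine Ideal.span_le.2 ?_ hz
        rintro _ ⟨i, hi, rfl⟩
        obtain ⟨b, rfl⟩ := Nat.exists_eq_add_of_le (show a i ≤ m from hi)
        rw [SetLike.mem_coe, mem_leftIdealQuotient, add_comm, pow_add, mul_smul]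
        exact Submodule.smul_of_tower_mem _ _
          (Submodule.mem_iSup_of_mem i (Ideal.mem_span_singleton_self _))
      rw [← sub_add_cancel x z, smul_add, hy, smul_smul, ← pow_succ]
      exact add_mem (ih (m + 1) (by omega) y hyD) hz'
  have hsup : 𝒞 = (⨆ i, Ideal.span {π ^ a i • e i} : Ideal (MonoidAlgebra R G)) := by
    refine le_antisymm (fun x hx => ?_) (iSup_le fun i => ?_)
    · simpa using hle ℓ 0 (zero_add ℓ) x (by simpa [D, mem_leftIdealQuotient] using hx)
    · rw [Ideal.span_singleton_le_iff_mem]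
      exact heD i
  have hind : iSupIndep fun i => (Ideal.span {π ^ a i • e i} : Ideal (MonoidAlgebra R G)) := by
    intro i
    rw [Submodule.disjoint_def]
    intro x hx hx'
    have hxi : x * e i = x := by
      obtain ⟨y, rfl⟩ := Ideal.mem_span_singleton'.1 hx
      rw [mul_assoc, smul_mul_assoc, (he i).1.eq]
    have hker : (⨆ j, ⨆ _ : j ≠ i, Ideal.span {π ^ a j • e j} : Ideal (MonoidAlgebra R G)) ≤
        LinearMap.ker (LinearMap.toSpanSingleton (MonoidAlgebra R G) _ (e i)) := by
      refine iSup₂_le fun j hj => ?_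
      rw [Ideal.span_singleton_le_iff_mem, LinearMap.mem_ker, LinearMap.toSpanSingleton_apply,
        smul_eq_mul, smul_mul_assoc, heo j i hj, smul_zero]
    rw [← hxi]
    exact hker hx'
  let σ := (Fintype.equivFin ι).symm
  refine ⟨Fintype.card ι, e ∘ σ, a ∘ σ, fun i => he _, fun i j hij => heo _ _ (σ.injective.ne hij),
    ?_, hind.comp σ.injective⟩
  rw [hsup]
  exact (σ.iSup_comp (g := fun i =>
    (Ideal.span {π ^ a i • e i} : Ideal (MonoidAlgebra R G)))).symm
end

section
/- Let ε_1, …, ε_s ∈ RG be pairwise orthogonal idempotents, a_1, …, a_s natural numbers, and 𝒞 = ⨁_{i=1}^s π^{a_i} RG ε_i. Then for every 0 ≤ j ≤ ℓ−1 one has 𝒞 ∩ 𝔪^j RG = RG·f_j, where f_j := ∑_{i : a_i ≤ j} π^j ε_i + ∑_{i : a_i > j} π^{a_i} ε_i. -/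
/-- Multiplying the combination `∑ k, x k * r k • ε k` of pairwise orthogonal idempotents on the
right by `ε i` picks out the `i`-th term. -/
theorem OrthogonalIdempotents.sum_mul_smul_mul {R A ι : Type*} [CommSemiring R] [Semiring A]
    [Algebra R A] [Fintype ι] {ε : ι → A} (h : OrthogonalIdempotents ε) (x : ι → A) (r : ι → R)
    (i : ι) : (∑ k, x k * r k • ε k) * ε i = x i * r i • ε i := by
  rw [Finset.sum_mul, Finset.sum_eq_single i]
  · rw [mul_assoc, smul_mul_assoc, (h.idem i).eq]
  · intro k _ hki
    rw [mul_assoc, smul_mul_assoc, h.ortho hki, smul_zero, mul_zero]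
  · simp

/-- The left ideal `⨁ i, A π ^ a i ε i` meets `A π ^ j` in the left ideal generated by
`∑ i, π ^ max (a i) j ε i`. -/
theorem OrthogonalIdempotents.iSup_span_pow_smul_inf_span {R A ι : Type*} [CommSemiring R]
    [Semiring A] [Algebra R A] [Fintype ι] {ε : ι → A} (h : OrthogonalIdempotents ε)
    (π : R) (a : ι → ℕ) (j : ℕ) :
    (⨆ i, Ideal.span {π ^ a i • ε i}) ⊓ Ideal.span {algebraMap R A (π ^ j)} =
      Ideal.span {∑ i, π ^ max (a i) j • ε i} := by
  apply le_antisymm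
  · rintro c ⟨hc, hcj⟩
    obtain ⟨y, rfl⟩ := Ideal.mem_span_singleton'.1 hcj
    rw [SetLike.mem_coe, ← Ideal.span_iUnion, Set.iUnion_singleton_eq_range, Ideal.span,
      Submodule.mem_span_range_iff_exists_fun] at hc
    obtain ⟨x, hx⟩ := hc
    simp only [smul_eq_mul] at hx
    have key (i : ι) : ∃ z, x i * π ^ a i • ε i = z * π ^ max (a i) j • ε i := by
      rcases le_total (a i) j with hij | hij
      · refine ⟨y, ?_⟩
        rw [max_eq_right hij, ← h.sum_mul_smul_mul x (fun k => π ^ a k) i, hx, mul_assoc,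
          Algebra.smul_def]
      · exact ⟨x i, by rw [max_eq_left hij]⟩
    choose z hz using key
    refine Ideal.mem_span_singleton'.2 ⟨∑ i, z i * ε i, ?_⟩
    rw [← hx, Finset.mul_sum]
    refine Finset.sum_congr rfl fun i _ => ?_
    have hzi := h.sum_mul_smul_mul z (fun _ => (1 : R)) i
    simp only [one_smul] at hzi
    rw [hz, mul_smul_comm, hzi, mul_smul_comm]
  · rw [Ideal.span_singleton_le_iff_mem]
    refine ⟨Submodule.sum_mem _ fun i _ => ?_, Submodule.sum_mem _ fun i _ => ?_⟩
    · refine Submodule.mem_iSup_of_mem i (Ideal.mem_span_singleton'.2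
        ⟨algebraMap R A (π ^ (max (a i) j - a i)), ?_⟩)
      rw [← Algebra.smul_def, smul_smul, ← pow_add, Nat.sub_add_cancel (le_max_left _ _)]
    · refine Ideal.mem_span_singleton'.2 ⟨π ^ (max (a i) j - j) • ε i, ?_⟩
      rw [← Algebra.commutes, ← Algebra.smul_def, smul_smul, ← pow_add,
        Nat.add_sub_cancel' (le_max_right _ _)]


/-- For pairwise orthogonal idempotents `ε_1, …, ε_s ∈ RG`, natural numbers
`a_1, …, a_s` and `𝒞 = ⨁_i π^{a_i} RG ε_i`, one has for every `0 ≤ j ≤ ℓ-1` that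
`𝒞 ∩ 𝔪^j RG = RG·f_j` with
`f_j = ∑_{a_i ≤ j} π^j ε_i + ∑_{a_i > j} π^{a_i} ε_i`. -/
theorem code_inter_power_of_maximal_ideal
    (R : Type) [CommRing R] [IsArtinianRing R] [IsLocalRing R]
    (π : R) (hπ : IsLocalRing.maximalIdeal R = Ideal.span {π})
    (ℓ : ℕ) (hℓ : 0 < ℓ)
    (hnil : IsLocalRing.maximalIdeal R ^ ℓ = ⊥)
    (hmin : ∀ k < ℓ, IsLocalRing.maximalIdeal R ^ k ≠ ⊥)
    (G : Type) [Group G] [Finite G]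
    (s : ℕ) (ε : Fin s → MonoidAlgebra R G) (a : Fin s → ℕ)
    (hidem : ∀ i, IsIdempotentElem (ε i))
    (horth : ∀ i j, i ≠ j → ε i * ε j = 0)
    (𝒞 : Ideal (MonoidAlgebra R G))
    (h𝒞 : 𝒞 = (⨆ i : Fin s, Ideal.span {π ^ a i • ε i} : Ideal (MonoidAlgebra R G)))
    (j : ℕ) (hj : j < ℓ)
    (f : MonoidAlgebra R G)
    (hf : f = (∑ i ∈ Finset.univ.filter (fun i : Fin s => a i ≤ j), π ^ j • ε i) +
        ∑ i ∈ Finset.univ.filter (fun i : Fin s => j < a i), π ^ a i • ε i) :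
    𝒞 ⊓ Ideal.span {algebraMap R (MonoidAlgebra R G) (π ^ j)} = Ideal.span {f} := by
  have hfmax : f = ∑ i, π ^ max (a i) j • ε i := by
    rw [hf, ← Finset.sum_filter_add_sum_filter_not Finset.univ (fun i => a i ≤ j)]
    simp only [not_le]
    congr 1 <;> refine Finset.sum_congr rfl fun i hi => ?_
    · rw [max_eq_right (Finset.mem_filter.1 hi).2]
    · rw [max_eq_left (Finset.mem_filter.1 hi).2.le]
  have h : OrthogonalIdempotents ε := ⟨hidem, fun i k hik => horth i k hik⟩
  rw [h𝒞, hfmax]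
  exact h.iSup_span_pow_smul_inf_span π a j
end
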